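/- Let d₁, d₃, d₄ be real numbers with (d₁+d₃+2d₄) ≠ 0 and (d₁+d₃+(8/5)d₄) ≠ 0, and set ψ_ε(x) = (2/3)((d₁+d₃+d₄)tanh(x) + (3/5)d₄ tanh³(x)). Then there exist ε₀ > 0, C > 0, and a function σ* : (0,ε₀) → ℝ with σ*(ε) → -(2/9)(d₁+d₃+(8/5)d₄)²(d₁+d₃+2d₄) as ε → 0⁺, such that for every ε ∈ (0,ε₀), if d₂ = -d₃ - d₄ - ε²σ*(ε), then there exist real-valued functions r, ψ on ℝ for which φ(x) = r(x)·exp(i∫₀ˣ ψ(s) ds) solves the steady-state complex ODE -(1/2)φ'' - φ + |φ|²φ = iε((1/2)d₁φ'' + d₂φ + d₃|φ|²φ + d₄|φ|⁴φ) on ℝ, and which satisfy sup_{x∈ℝ} |r(x) - tanh(x)| ≤ Cε² and sup_{x∈ℝ} |ψ(x) - ε·ψ_ε(x)| ≤ Cε³. -/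

import Mathlib

open Filter

/-- The solution in polar form φ(x) = r(x) exp(i ∫₀ˣ ψ(s) ds). -/
noncomputable def polarSol (r ψ : ℝ → ℝ) : ℝ → ℂ :=
  fun x => (r x : ℂ) * Complex.exp (Complex.I * (∫ s in (0:ℝ)..x, ψ s))

/-- The steady-state complex ODE
  -(1/2)φ'' - φ + |φ|²φ = iε((1/2)d₁φ'' + d₂φ + d₃|φ|²φ + d₄|φ|⁴φ). -/
def steadyODE (d₁ d₂ d₃ d₄ ε : ℝ) (φ : ℝ → ℂ) : Prop :=
  ∀ x : ℝ,
    -(1/2 : ℂ) * deriv (deriv φ) x - φ x + (‖φ x‖ : ℂ)^2 * φ x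
      = Complex.I * (ε : ℂ) *
        ((1/2 : ℂ) * (d₁ : ℂ) * deriv (deriv φ) x + (d₂ : ℂ) * φ x
          + (d₃ : ℂ) * (‖φ x‖ : ℂ)^2 * φ x + (d₄ : ℂ) * (‖φ x‖ : ℂ)^4 * φ x)

/-- First-order phase correction ψ_ε. -/
noncomputable def psiEps (d₁ d₃ d₄ : ℝ) (x : ℝ) : ℝ :=
  (2/3) * ((d₁ + d₃ + d₄) * Real.tanh x + (3/5) * d₄ * Real.tanh x ^ 3)

/-- Continuous functions on the unit interval. -/
abbrev CI := C(Set.Icc (0:ℝ) 1, ℝ)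

/-- Constant extension to the line. -/
noncomputable def cext (f : CI) : ℝ → ℝ := fun x => f (Set.projIcc 0 1 zero_le_one x)

lemma cext_cont (f : CI) : Continuous (cext f) := f.continuous.comp continuous_projIcc

lemma cext_abs_le (f : CI) (x : ℝ) : |cext f x| ≤ ‖f‖ := f.norm_coe_le_norm _

lemma cext_of_mem (f : CI) {x : ℝ} (hx : x ∈ Set.Icc (0:ℝ) 1) : cext f x = f ⟨x, hx⟩ := by
  unfold cext; rw [Set.projIcc_of_mem]

/-- Averaging operator `f ↦ (τ ↦ ∫ v in 0..1, k v * f (m τ v))`. -/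
noncomputable def avg (k : ℝ → ℝ) (m : ℝ → ℝ → ℝ) (hk : Continuous k)
    (hm : Continuous (Function.uncurry m)) (hk1 : ∀ v ∈ Set.Icc (0:ℝ) 1, |k v| ≤ 1) :
    CI →L[ℝ] CI :=
  LinearMap.mkContinuous
    { toFun := fun f => ⟨fun τ => ∫ v in (0:ℝ)..1, k v * cext f (m τ v), by
        apply intervalIntegral.continuous_parametric_intervalIntegral_of_continuous'
        have := cext_cont f
        have h2 : Continuous (fun p : Set.Icc (0:ℝ) 1 × ℝ => m p.1 p.2) :=
          hm.comp (by fun_prop : Continuous (fun p : Set.Icc (0:ℝ) 1 × ℝ => ((p.1 : ℝ), p.2)))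
        simp only [Function.uncurry_def]
        fun_prop⟩
      map_add' := fun f g => by
        ext τ
        have h2 : Continuous (fun v : ℝ => m τ v) :=
          hm.comp (by fun_prop : Continuous (fun v : ℝ => ((τ : ℝ), v)))
        have hf := cext_cont f
        have hg := cext_cont g
        simp only [ContinuousMap.coe_mk, ContinuousMap.add_apply]
        rw [← intervalIntegral.integral_add]
        · congr 1; ext v; simp only [cext, ContinuousMap.add_apply]; ring
        · apply Continuous.intervalIntegrable; fun_prop
        · apply Continuous.intervalIntegrable; fun_prop
      map_smul' := fun c f => by
        ext τ
        simp only [ContinuousMap.coe_mk, ContinuousMap.smul_apply, RingHom.id_apply, smul_eq_mul]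
        rw [← intervalIntegral.integral_const_mul]
        congr 1; ext v; simp only [cext, ContinuousMap.smul_apply, smul_eq_mul]; ring }
    1 (fun f => by
      rw [one_mul, ContinuousMap.norm_le _ (norm_nonneg _)]
      intro τ
      have := intervalIntegral.norm_integral_le_of_norm_le_const (a := (0:ℝ)) (b := 1)
        (f := fun v => k v * cext f (m τ v)) (C := ‖f‖) (fun v hv => by
          rw [Set.uIoc_of_le zero_le_one] at hv
          rw [norm_mul]
          have h1 := hk1 v ⟨hv.1.le, hv.2⟩
          have h2 := cext_abs_le f (m τ v)
          calc _ ≤ 1 * ‖f‖ := mul_le_mul h1 h2 (abs_nonneg _) zero_le_one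
            _ = _ := one_mul _)
      simpa using this)

lemma avg_apply (k : ℝ → ℝ) (m : ℝ → ℝ → ℝ) (hk : Continuous k)
    (hm : Continuous (Function.uncurry m)) (hk1 : ∀ v ∈ Set.Icc (0:ℝ) 1, |k v| ≤ 1) (f : CI)
    (τ : Set.Icc (0:ℝ) 1) :
    avg k m hk hm hk1 f τ = ∫ v in (0:ℝ)..1, k v * cext f (m τ v) := rfl

noncomputable def K1 : CI →L[ℝ] CI := avg (fun w => w^2) (fun τ w => τ * w^2) (by fun_prop)
  (by simp only [Function.uncurry_def]; fun_prop)
  (fun v hv => by rw [abs_of_nonneg (by positivity)]; exact pow_le_one₀ hv.1 hv.2)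

noncomputable def K2 : CI →L[ℝ] CI := avg (fun _ => 1) (fun τ v => 1 - (1 - τ) * v) (by fun_prop)
  (by simp only [Function.uncurry_def]; fun_prop) (fun v hv => by simp)

noncomputable def K3 : CI →L[ℝ] CI := avg (fun v => v) (fun τ v => 1 - (1 - τ) * v) (by fun_prop)
  (by simp only [Function.uncurry_def]; fun_prop)
  (fun v hv => by rw [abs_of_nonneg hv.1]; exact hv.2)

/-- The coordinate function. -/
def idC : CI := ⟨fun τ => τ, by fun_prop⟩

noncomputable def oneI : Set.Icc (0:ℝ) 1 := ⟨1, by simp⟩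

noncomputable def ev1 : CI →L[ℝ] ℝ := ContinuousMap.evalCLM ℝ oneI

noncomputable def cF (d₁ μ : ℝ) : ℝ := 2 / (1 + μ * d₁^2)

noncomputable def BF (d₁ d₃ d₄ δ : ℝ) : CI := (d₁ + d₃) • (1 : CI) + (d₄ * (1 - δ)) • ((1 : CI) + idC)

noncomputable def hF (d₁ d₃ d₄ : ℝ) (p : ℝ × CI × ℝ) : CI :=
  cF d₁ p.1 • (BF d₁ d₃ d₄ p.2.2 * p.2.1)

noncomputable def eF (d₁ d₃ d₄ : ℝ) (p : ℝ × CI × ℝ) : CI := K1 (hF d₁ d₃ d₄ p)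

noncomputable def gF (d₁ d₃ d₄ : ℝ) (p : ℝ × CI × ℝ) : CI :=
  (2:ℝ) • (1 : CI) + p.1 • (K2 (eF d₁ d₃ d₄ p * hF d₁ d₃ d₄ p - (2:ℝ) • (eF d₁ d₃ d₄ p * eF d₁ d₃ d₄ p))
    - (d₁ * cF d₁ p.1) • BF d₁ d₃ d₄ p.2.2)

noncomputable def FF (d₁ d₃ d₄ : ℝ) (p : ℝ × CI × ℝ) : CI × ℝ :=
  (p.2.1 * p.2.1 * K3 (gF d₁ d₃ d₄ p) - 1,
    p.2.2 - p.1 * (1 - p.2.2) * (ev1 (eF d₁ d₃ d₄ p))^2 / 2)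

lemma hF_contDiffAt (d₁ d₃ d₄ : ℝ) (u : CI × ℝ) : ContDiffAt ℝ 1 (hF d₁ d₃ d₄) (0, u) := by
  unfold hF cF BF
  have : (1 + (0:ℝ) * d₁^2) ≠ 0 := by simp
  have h1 : ContDiffAt ℝ 1 (fun p : ℝ × CI × ℝ => 2 / (1 + p.1 * d₁^2)) (0, u) := by
    apply ContDiffAt.div
    · fun_prop
    · fun_prop
    · simp
  apply h1.smul
  fun_prop

lemma eF_contDiffAt (d₁ d₃ d₄ : ℝ) (u : CI × ℝ) : ContDiffAt ℝ 1 (eF d₁ d₃ d₄) (0, u) := by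
  have := hF_contDiffAt d₁ d₃ d₄ u
  unfold eF
  fun_prop

lemma FF_contDiffAt (d₁ d₃ d₄ : ℝ) (u : CI × ℝ) : ContDiffAt ℝ 1 (FF d₁ d₃ d₄) (0, u) := by
  have h1 : ContDiffAt ℝ 1 (fun p : ℝ × CI × ℝ => 2 / (1 + p.1 * d₁^2)) (0, u) := by
    apply ContDiffAt.div
    · fun_prop
    · fun_prop
    · simp
  have hh := hF_contDiffAt d₁ d₃ d₄ u
  have he := eF_contDiffAt d₁ d₃ d₄ u
  have hg : ContDiffAt ℝ 1 (gF d₁ d₃ d₄) (0, u) := by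
    unfold gF cF BF
    fun_prop
  unfold FF
  fun_prop

lemma K3_one : K3 ((2:ℝ) • (1 : CI)) = 1 := by
  ext τ
  simp only [K3, avg_apply, cext]
  simp

lemma FF_zero (d₁ d₃ d₄ : ℝ) (u : CI × ℝ) : FF d₁ d₃ d₄ (0, u) = (u.1 * u.1 - 1, u.2) := by
  have : gF d₁ d₃ d₄ (0, u) = (2:ℝ) • (1 : CI) := by simp [gF]
  simp only [FF, this, K3_one]
  simp

lemma implicit_exists (d₁ d₃ d₄ : ℝ) : ∃ U : ℝ → CI × ℝ, U 0 = (1, 0) ∧ DifferentiableAt ℝ U 0 ∧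
    ∀ᶠ μ in nhds (0:ℝ), FF d₁ d₃ d₄ (μ, U μ) = 0 := by
  have hs := (FF_contDiffAt d₁ d₃ d₄ (1, 0)).hasStrictFDerivAt one_ne_zero
  set L := fderiv ℝ (FF d₁ d₃ d₄) (0, (1, 0)) with hL
  have hL2 : L ∘L .inr ℝ ℝ (CI × ℝ) =
      (((2:ℝ) • ContinuousLinearMap.fst ℝ CI ℝ).prod (ContinuousLinearMap.snd ℝ CI ℝ)) := by
    have h1 : HasFDerivAt (fun u : CI × ℝ => FF d₁ d₃ d₄ (0, u)) (L ∘L .inr ℝ ℝ (CI × ℝ)) (1, 0) :=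
      HasFDerivAt.comp (1, 0) (hs.hasFDerivAt) (hasFDerivAt_prodMk_right 0 (1, 0))
    have h2 : HasFDerivAt (fun u : CI × ℝ => FF d₁ d₃ d₄ (0, u))
        (((2:ℝ) • ContinuousLinearMap.fst ℝ CI ℝ).prod (ContinuousLinearMap.snd ℝ CI ℝ)) (1, 0) := by
      have e : (fun u : CI × ℝ => FF d₁ d₃ d₄ (0, u)) = fun u => (u.1 * u.1 - 1, u.2) := by
        ext1 u; exact FF_zero d₁ d₃ d₄ u
      rw [e]
      have h3 : HasFDerivAt (fun u : CI × ℝ => u.1) (ContinuousLinearMap.fst ℝ CI ℝ) (1, 0) :=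
        hasFDerivAt_fst
      refine HasFDerivAt.prodMk ?_ hasFDerivAt_snd
      convert (h3.mul' h3).sub_const (1 : CI) using 1
      · rfl
      refine ContinuousLinearMap.ext fun u => ?_
      change (2:ℝ) • u.1 = 1 * u.1 + u.1 * 1
      rw [two_smul, one_mul, mul_one]
    exact h1.unique h2
  have hinv : (L ∘L .inr ℝ ℝ (CI × ℝ)).IsInvertible := by
    rw [hL2]
    refine ContinuousLinearMap.IsInvertible.of_inverse (g := (((1/2:ℝ) • ContinuousLinearMap.fst ℝ CI ℝ).prod (ContinuousLinearMap.snd ℝ CI ℝ))) ?_ ?_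
    · refine ContinuousLinearMap.ext fun u => Prod.ext ?_ ?_ <;> simp
    · refine ContinuousLinearMap.ext fun u => Prod.ext ?_ ?_ <;> simp
  refine ⟨hs.implicitFunctionOfProdDomain hinv, ?_, ?_, ?_⟩
  · exact (hs.eventually_apply_eq_iff_implicitFunctionOfProdDomain hinv).self_of_nhds.mp rfl
  · exact (hs.hasStrictFDerivAt_implicitFunctionOfProdDomain hinv).hasFDerivAt.differentiableAt
  · have := hs.eventually_apply_implicitFunctionOfProdDomain hinv
    filter_upwards [this] with μ h
    rw [h, FF_zero]
    simp

lemma K1_id (h : CI) {ρ : ℝ} (hρ : ρ^2 ≤ 1) :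
    ρ^3 * cext (K1 h) (ρ^2) = ∫ w in (0:ℝ)..ρ, w^2 * cext h (w^2) := by
  rw [cext_of_mem _ (⟨sq_nonneg ρ, hρ⟩ : ρ^2 ∈ Set.Icc (0:ℝ) 1), K1, avg_apply]
  have := intervalIntegral.mul_integral_comp_mul_left (a := 0) (b := 1)
    (f := fun w => w^2 * cext h (w^2)) ρ
  rw [mul_zero, mul_one] at this
  rw [← this, pow_succ' ρ 2, mul_assoc, ← intervalIntegral.integral_const_mul]
  congr 2
  ext v
  simp only [mul_pow]
  ring

lemma K2_id (f : CI) {τ : ℝ} (hτ : τ ∈ Set.Icc (0:ℝ) 1) :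
    (1 - τ) * cext (K2 f) τ = ∫ u in τ..1, cext f u := by
  rw [cext_of_mem _ hτ, K2, avg_apply]
  have := intervalIntegral.mul_integral_comp_sub_mul (a := 0) (b := 1)
    (f := fun u => cext f u) (1 - τ) 1
  simp only [mul_zero, mul_one, sub_zero, sub_sub_cancel] at this
  rw [← this]
  simp

lemma K3_id (f : CI) {τ : ℝ} (hτ : τ ∈ Set.Icc (0:ℝ) 1) :
    (1 - τ)^2 * cext (K3 f) τ = ∫ u in τ..1, (1 - u) * cext f u := by
  rw [cext_of_mem _ hτ, K3, avg_apply]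
  have := intervalIntegral.mul_integral_comp_sub_mul (a := 0) (b := 1)
    (f := fun u => (1 - u) * cext f u) (1 - τ) 1
  simp only [mul_zero, mul_one, sub_zero, sub_sub_cancel] at this
  rw [← this, sq, mul_assoc, ← intervalIntegral.integral_const_mul]
  congr 2
  ext v
  ring

lemma w_deriv (h : CI) {ρ : ℝ} (hρ : ρ^2 < 1) :
    HasDerivAt (fun ρ : ℝ => ρ^2 * cext (K1 h) (ρ^2))
      (ρ * (cext h (ρ^2) - cext (K1 h) (ρ^2))) ρ := by
  by_cases h0 : ρ = 0
  · subst h0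
    rw [hasDerivAt_iff_tendsto_slope_zero]
    have hc : Continuous (fun t : ℝ => t * cext (K1 h) (t^2)) := by
      have := cext_cont (K1 h)
      fun_prop
    have h1 : Tendsto (fun t : ℝ => t * cext (K1 h) (t^2)) (nhdsWithin 0 {0}ᶜ)
        (nhds (0 * cext (K1 h) (0^2))) := (hc.tendsto 0).mono_left nhdsWithin_le_nhds
    rw [zero_mul] at h1 ⊢
    refine h1.congr' ?_
    filter_upwards [self_mem_nhdsWithin] with t ht
    have : t ≠ 0 := ht
    simp
    field_simp
  · have hc := cext_cont h
    have hN : HasDerivAt (fun ρ : ℝ => ∫ w in (0:ℝ)..ρ, w^2 * cext h (w^2)) (ρ^2 * cext h (ρ^2)) ρ :=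
      (Continuous.integral_hasStrictDerivAt (f := fun w => w^2 * cext h (w^2)) (by fun_prop) 0 ρ).hasDerivAt
    have hd := hN.div (hasDerivAt_id ρ) h0
    have hid := K1_id h hρ.le
    have hev : (fun ρ : ℝ => ρ^2 * cext (K1 h) (ρ^2)) =ᶠ[nhds ρ]
        ((fun ρ : ℝ => ∫ w in (0:ℝ)..ρ, w^2 * cext h (w^2)) / id) := by
      have ho : {ρ : ℝ | ρ^2 < 1 ∧ ρ ≠ 0} ∈ nhds ρ := by
        have o1 : IsOpen {ρ : ℝ | ρ^2 < 1} := isOpen_lt (by fun_prop) (by fun_prop)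
        have o2 : IsOpen {ρ : ℝ | ρ ≠ 0} := isOpen_ne
        exact (o1.inter o2).mem_nhds ⟨hρ, h0⟩
      filter_upwards [ho] with x hx
      have := hx.2
      simp only [Pi.div_apply, id]
      rw [← K1_id h hx.1.le]
      field_simp
    refine (hd.congr_of_eventuallyEq hev).congr_deriv ?_
    rw [← hid]
    simp only [id]
    field_simp

lemma D_id (h : CI) {τ : ℝ} (hτ : τ ∈ Set.Icc (0:ℝ) 1) :
    (1 - τ) * cext (K2 (K1 h * h - (2:ℝ) • (K1 h * K1 h))) τ
      = (cext (K1 h) 1)^2 - τ * (cext (K1 h) τ)^2 := by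
  rw [K2_id _ hτ]
  have hc := cext_cont (K1 h)
  have hi := intervalIntegral.integral_eq_sub_of_hasDerivAt_of_le
    (f := fun τ => τ * (cext (K1 h) τ)^2)
    (f' := cext (K1 h * h - (2:ℝ) • (K1 h * K1 h))) hτ.2 (by fun_prop) (fun u hu => by
      have hu0 : 0 < u := lt_of_le_of_lt hτ.1 hu.1
      have hsq : (√u)^2 = u := Real.sq_sqrt hu0.le
      have hs0 : √u ≠ 0 := (Real.sqrt_pos.2 hu0).ne'
      have h1 := w_deriv h (ρ := √u) (by rw [hsq]; exact hu.2)
      have h2 := h1.comp u (Real.hasDerivAt_sqrt hu0.ne')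
      have h3 := (h2.pow 2).div (hasDerivAt_id u) hu0.ne'
      have hev : (fun τ => τ * (cext (K1 h) τ)^2) =ᶠ[nhds u]
         (((fun ρ : ℝ => ρ^2 * cext (K1 h) (ρ^2)) ∘ fun u => √u) ^ 2) / id := by
        filter_upwards [isOpen_Ioi.mem_nhds hu0] with x hx
        have hx' : 0 < x := hx
        simp only [Pi.div_apply, id, Pi.pow_apply, Function.comp, Real.sq_sqrt hx'.le]
        field_simp
      refine (h3.congr_of_eventuallyEq hev).congr_deriv ?_
      simp only [Function.comp, hsq, id, Pi.pow_apply]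
      have : cext (K1 h * h - (2:ℝ) • (K1 h * K1 h)) u =
        cext (K1 h) u * cext h u - 2 * (cext (K1 h) u * cext (K1 h) u) := by simp [cext]
      rw [this]
      field_simp
      ring_nf) ((cext_cont _).intervalIntegrable _ _)
  rw [hi]
  ring

lemma tanh_deriv (x : ℝ) : HasDerivAt Real.tanh (1 - Real.tanh x^2) x := by
  have h : Real.tanh = fun x => Real.sinh x / Real.cosh x := by
    ext1 x; exact Real.tanh_eq_sinh_div_cosh x
  have hc := (Real.cosh_pos x).ne'
  rw [h]
  refine ((Real.hasDerivAt_sinh x).div (Real.hasDerivAt_cosh x) hc).congr_deriv ?_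
  field_simp

lemma tanh_slope_le {c ξ : ℝ} (hc : 0 ≤ c) (h : c ≤ ξ) : 2 * c * (1 - Real.tanh ξ^2) ≤ 1 := by
  have h1 : 1 - Real.tanh ξ^2 = 1 / Real.cosh ξ^2 := by
    have := (Real.cosh_pos ξ).ne'
    rw [Real.tanh_eq_sinh_div_cosh]
    field_simp
    rw [Real.cosh_sq]; ring
  have h2 : c ≤ Real.sinh ξ := h.trans (Real.self_le_sinh_iff.2 (hc.trans h))
  rw [h1, mul_one_div, div_le_one (by positivity), Real.cosh_sq]
  nlinarith [sq_nonneg (Real.sinh ξ - 1)]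

lemma tanh_est_pos {κ X y : ℝ} (hκ0 : 0 ≤ κ) (hκ : κ ≤ 1/2) (hy : 0 ≤ y) (h : |X - y| ≤ κ * y) :
    |Real.tanh y - Real.tanh X| ≤ κ := by
  rcases hy.eq_or_lt with rfl | hy
  · have : X = 0 := by
      have := abs_nonneg (X - 0)
      have : |X - 0| = 0 := by linarith
      simpa using this
    subst this
    simpa using hκ0
  have hX := abs_le.1 h
  have := Convex.norm_image_sub_le_of_norm_hasDerivWithin_le (f := Real.tanh)
    (f' := fun x => 1 - Real.tanh x^2) (s := Set.Ici (y/2)) (x := X) (y := y) (C := 1/y)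
    (fun x _ => (tanh_deriv x).hasDerivWithinAt) (fun x hx => by
      have h1 := tanh_slope_le (by positivity) (Set.mem_Ici.1 hx)
      have h2 := Real.tanh_sq_lt_one x
      rw [Real.norm_eq_abs, abs_of_pos (by linarith), le_div_iff₀ hy]
      linarith) (convex_Ici _) (by simp only [Set.mem_Ici]; nlinarith) (by simp only [Set.mem_Ici]; linarith)
  rw [Real.norm_eq_abs, Real.norm_eq_abs, abs_sub_comm y X] at this
  refine this.trans ?_
  rw [div_mul_eq_mul_div, one_mul, div_le_iff₀ hy]
  exact h


lemma tanh_est {κ X y : ℝ} (hκ0 : 0 ≤ κ) (hκ : κ ≤ 1/2) (h : |X - y| ≤ κ * |y|) :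
    |Real.tanh y - Real.tanh X| ≤ κ := by
  rcases le_total 0 y with hy | hy
  · exact tanh_est_pos hκ0 hκ hy (by rwa [abs_of_nonneg hy] at h)
  · have := tanh_est_pos (X := -X) (y := -y) hκ0 hκ (by linarith) (by
      rw [abs_of_nonpos hy] at h
      rwa [neg_sub_neg, abs_sub_comm])
    rwa [Real.tanh_neg, Real.tanh_neg, neg_sub_neg, abs_sub_comm] at this

lemma Y_exists (w : ℝ → ℝ) (hw : Continuous w) {κ : ℝ} (hκ0 : 0 ≤ κ) (hκ : κ ≤ 1/2)
    (hb : ∀ t, |w t - 1| ≤ κ) :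
    ∃ Y : ℝ → ℝ, (∀ x, HasDerivAt Y (w (Y x))⁻¹ x) ∧
      ∀ x, |Real.tanh (Y x) - Real.tanh x| ≤ κ := by
  set X : ℝ → ℝ := fun y => ∫ t in (0:ℝ)..y, w t with hX
  have hd : ∀ y, HasDerivAt X (w y) y := fun y => (hw.integral_hasStrictDerivAt 0 y).hasDerivAt
  have hpos : ∀ y, 0 < w y := fun y => by have := (abs_le.1 (hb y)).1; linarith
  have hmono : StrictMono X := strictMono_of_hasDerivAt_pos hd hpos
  have hcont : Continuous X := continuous_iff_continuousAt.2 fun y => (hd y).continuousAt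
  have hest : ∀ y, |X y - y| ≤ κ * |y| := fun y => by
    have h1 : X y - y = ∫ t in (0:ℝ)..y, (w t - 1) := by
      rw [intervalIntegral.integral_sub (hw.intervalIntegrable _ _) (by simp)]
      simp [hX]
    rw [h1]
    have := intervalIntegral.norm_integral_le_of_norm_le_const (a := (0:ℝ)) (b := y)
      (f := fun t => w t - 1) (C := κ) (fun t _ => hb t)
    simpa using this
  have hsurj : Function.Surjective X := by
    apply hcont.surjective
    · refine tendsto_atTop_mono' atTop (f₁ := fun y => y / 2) ?_ (tendsto_id.atTop_div_const two_pos)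
      filter_upwards [eventually_ge_atTop 0] with y hy
      have h1 := (abs_le.1 (hest y)).1
      rw [abs_of_nonneg hy] at h1
      nlinarith
    · refine tendsto_atBot_mono' atBot (f₁ := fun y => y / 2) (f₂ := X) ?_ ((tendsto_id (α := ℝ)).atBot_div_const (two_pos : (0:ℝ) < 2))
      filter_upwards [eventually_le_atBot 0] with y hy
      have h1 := (abs_le.1 (hest y)).2
      rw [abs_of_nonpos hy] at h1
      nlinarith
  set e := hmono.orderIsoOfSurjective X hsurj with he
  have hXe : ∀ x, X (e.symm x) = x := fun x => e.apply_symm_apply x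
  refine ⟨e.symm, fun x => ?_, fun x => ?_⟩
  · exact HasDerivAt.of_local_left_inverse e.symm.continuous.continuousAt (hd _) (hpos _).ne'
      (Eventually.of_forall hXe)
  · have := tanh_est hκ0 hκ (hest (e.symm x))
    rwa [hXe] at this

lemma ode_main (d₁ d₃ d₄ ε δ : ℝ) (z : CI) (hFF : FF d₁ d₃ d₄ (ε^2, z, δ) = 0) (hδ : δ < 1)
    (hz : ∀ τ, 0 < cext z τ) (T : ℝ → ℝ)
    (hT : ∀ x, HasDerivAt T (√(1-δ) * (1 - T x^2) / cext z (T x^2)) x) (hT1 : ∀ x, T x^2 < 1) :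
    steadyODE d₁ (d₁ - (d₁ + d₃) * (1 - δ) - d₄ * (1 - δ)^2) d₃ d₄ ε
      (polarSol (fun x => √(1-δ) * T x)
        (fun x => ε * (√(1-δ) * T x) * cext (eF d₁ d₃ d₄ (ε^2, z, δ)) (T x^2))) := by
  set a := √(1-δ) with ha
  have haS : a^2 = 1 - δ := Real.sq_sqrt (by linarith)
  have hapos : 0 < a := Real.sqrt_pos.2 (by linarith)
  set S := 1 - δ with hS
  have hSpos : 0 < S := by linarith
  set h := hF d₁ d₃ d₄ (ε^2, z, δ) with hh
  have heK : eF d₁ d₃ d₄ (ε^2, z, δ) = K1 h := rfl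
  set g := gF d₁ d₃ d₄ (ε^2, z, δ) with hg
  rw [heK]
  have hF1 : z * z * K3 g - 1 = 0 := congrArg Prod.fst hFF
  have hF2 : δ - ε^2 * S * (cext (K1 h) 1)^2 / 2 = 0 := by
    have : δ - ε^2 * S * (ev1 (K1 h))^2 / 2 = 0 := congrArg Prod.snd hFF
    rwa [show ev1 (K1 h) = cext (K1 h) 1 by
      rw [cext_of_mem _ (by simp : (1:ℝ) ∈ Set.Icc (0:ℝ) 1)]; rfl] at this
  have hmem : ∀ x, T x^2 ∈ Set.Icc (0:ℝ) 1 := fun x => ⟨sq_nonneg _, (hT1 x).le⟩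
  have hTc : Continuous T := continuous_iff_continuousAt.2 fun y => (hT y).continuousAt
  have hec := cext_cont (K1 h)
  set ψ : ℝ → ℝ := fun x => ε * (a * T x) * cext (K1 h) (T x^2) with hψ
  have hψc : Continuous ψ := by fun_prop
  set c := cF d₁ (ε^2) with hc
  have hc2 : c * (1 + ε^2 * d₁^2) = 2 := by
    rw [hc, cF]; field_simp
  set B : ℝ → ℝ := fun x => d₁ + d₃ + d₄ * S * (1 + T x^2) with hB
  have hBv : ∀ x, cext (BF d₁ d₃ d₄ δ) (T x^2) = B x := fun x => by
    rw [cext_of_mem _ (hmem x)]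
    simp [BF, hB, idC, hS]
    ring
  have hhv : ∀ x, cext h (T x^2) = c * B x * cext z (T x^2) := fun x => by
    rw [← hBv, mul_assoc]; rfl
  have hgv : ∀ x, (1 - T x^2) * cext g (T x^2) = 2 * (1 - T x^2) +
      ε^2 * ((cext (K1 h) 1)^2 - T x^2 * (cext (K1 h) (T x^2))^2 - d₁ * c * B x * (1 - T x^2)) :=
    fun x => by
    rw [← D_id h (hmem x), ← hBv]
    have : cext g (T x^2) = 2 + ε^2 * (cext (K2 (K1 h * h - (2:ℝ) • (K1 h * K1 h))) (T x^2)
      - d₁ * c * cext (BF d₁ d₃ d₄ δ) (T x^2)) := by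
      simp [hg, gF, cext, heK, ← hh, ← hc]
    rw [this]; ring
  -- derivative of p
  set p : ℝ → ℝ := fun x => S * (1 - T x^2) / cext z (T x^2) with hp
  have hpd : ∀ x, HasDerivAt p (-(a * S) * T x * ((1 - T x^2) * cext g (T x^2))) x := by
    intro x
    have hPi : ∀ τ, HasDerivAt (fun τ => ∫ u in τ..1, (1 - u) * cext g u) (-((1 - τ) * cext g τ)) τ := by
      intro τ
      have hgc := cext_cont g
      have := (Continuous.integral_hasStrictDerivAt (f := fun u => (1 - u) * cext g u)
        (by fun_prop) 1 τ).hasDerivAt.neg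
      refine this.congr_of_eventuallyEq (Eventually.of_forall fun t => ?_)
      exact intervalIntegral.integral_symm _ _
    have hval : ∀ x, (∫ u in (T x^2)..1, (1 - u) * cext g u) = ((1 - T x^2) / cext z (T x^2))^2 := by
      intro x
      rw [← K3_id g (hmem x)]
      have h1 : cext z (T x^2) * cext z (T x^2) * cext (K3 g) (T x^2) = 1 := by
        have := congrArg (fun f : CI => cext f (T x^2)) (sub_eq_zero.1 hF1)
        simpa [cext] using this
      have := (hz (T x^2)).ne'
      field_simp
      linear_combination (1 - T x^2)^2 * h1
    have hpos : ∀ x, 0 < (1 - T x^2) / cext z (T x^2) := fun x =>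
      div_pos (by linarith [hT1 x]) (hz _)
    have hps : p = fun x => S * √(∫ u in (T x^2)..1, (1 - u) * cext g u) := by
      ext1 x
      rw [hval, Real.sqrt_sq (hpos x).le, hp]
      ring
    rw [hps]
    have h1 := (hPi (T x^2)).comp x ((hT x).pow 2)
    have h2 := (h1.sqrt (by
      simp only [Function.comp, Pi.pow_apply]; rw [hval]; exact (pow_pos (hpos x) 2).ne')).const_mul S
    refine h2.congr_deriv ?_
    simp only [Function.comp, Pi.pow_apply]
    rw [hval, Real.sqrt_sq (hpos x).le]
    have e1 := (hz (T x^2)).ne'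
    have e2 : 1 - T x^2 ≠ 0 := by linarith [hT1 x]
    field_simp
    ring
  -- derivative of q
  set q : ℝ → ℝ := fun x => ε * S * (T x^2 * cext (K1 h) (T x^2)) with hq
  have hqd : ∀ x, HasDerivAt q (ε * S * (T x * (cext h (T x^2) - cext (K1 h) (T x^2)) *
      (a * (1 - T x^2) / cext z (T x^2)))) x := fun x =>
    ((w_deriv h (hT1 x)).comp x (hT x)).const_mul (ε * S)
  -- the phase factor
  set Θ : ℝ → ℂ := fun x => Complex.exp (Complex.I * ((∫ s in (0:ℝ)..x, ψ s : ℝ) : ℂ)) with hΘ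
  have hΘd : ∀ x, HasDerivAt Θ (Complex.I * ψ x * Θ x) x := fun x => by
    have h1 := ((hψc.integral_hasStrictDerivAt 0 x).hasDerivAt.ofReal_comp.const_mul Complex.I).cexp
    refine h1.congr_deriv ?_
    rw [hΘ]; ring
  set φ := polarSol (fun x => a * T x) ψ with hφ
  have hφe : φ = fun x => ((a * T x : ℝ) : ℂ) * Θ x := rfl
  have hrd : ∀ x, HasDerivAt (fun x => a * T x) (p x) x := fun x => by
    refine ((hT x).const_mul a).congr_deriv ?_
    rw [hp, ← haS]; ring
  have hφ1 : ∀ x, HasDerivAt φ (((p x : ℂ) + Complex.I * q x) * Θ x) x := fun x => by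
    rw [hφe]
    refine ((hrd x).ofReal_comp.mul (hΘd x)).congr_deriv ?_
    have : q x = a * T x * ψ x := by
      simp only [hq, hψ, ← haS]; ring
    rw [this]; push_cast; ring
  have hφ1' : deriv φ = fun x => ((p x : ℂ) + Complex.I * q x) * Θ x := by
    ext1 x; exact (hφ1 x).deriv
  intro x
  set β := ε * c * S * (1 - T x^2) * B x with hβ
  have hφ2 : deriv (deriv φ) x =
      ((a * T x : ℝ) : ℂ) * (((2 * (S * T x^2 - 1) + ε * d₁ * β : ℝ) : ℂ) + Complex.I * (β : ℝ)) * Θ x := by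
    rw [hφ1']
    have h1 := ((hpd x).ofReal_comp.add ((hqd x).ofReal_comp.const_mul Complex.I)).mul (hΘd x)
    refine h1.deriv.trans ?_
    have e1 := (hz (T x^2)).ne'
    have hR : -(a * S) * T x * ((1 - T x^2) * cext g (T x^2)) - q x * ψ x =
        a * T x * (2 * (S * T x^2 - 1) + ε * d₁ * β) := by
      rw [hgv]
      simp only [hq, hψ, hβ]
      linear_combination (2 * a * T x) * hF2 + (2 * a * T x) * hS
    have hI : ε * S * (T x * (cext h (T x^2) - cext (K1 h) (T x^2)) *
      (a * (1 - T x^2) / cext z (T x^2))) + p x * ψ x = a * T x * β := by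
      rw [hhv]
      simp only [hp, hψ, hβ]
      field_simp
      ring
    have hR' := congrArg (fun t : ℝ => (t : ℂ)) hR
    have hI' := congrArg (fun t : ℝ => (t : ℂ)) hI
    simp only [Pi.add_apply]
    push_cast at hR' hI' ⊢
    linear_combination Θ x * hR' + Complex.I * Θ x * hI' +
      (q x * ψ x * Θ x) * Complex.I_sq
  have hΘn : ‖Θ x‖ = 1 := by
    rw [hΘ]; simp only
    rw [mul_comm, Complex.norm_exp_ofReal_mul_I]
  have hn : (‖φ x‖ : ℂ)^2 = ((a * T x : ℝ) : ℂ)^2 := by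
    rw [hφe]; simp only
    rw [norm_mul, hΘn, mul_one, Complex.norm_real, Real.norm_eq_abs, ← Complex.ofReal_pow, sq_abs,
      Complex.ofReal_pow]
  have hn4 : (‖φ x‖ : ℂ)^4 = ((a * T x : ℝ) : ℂ)^4 := by
    calc (‖φ x‖ : ℂ)^4 = ((‖φ x‖ : ℂ)^2)^2 := by ring
      _ = _ := by rw [hn]; ring
  have hr2 : (a * T x)^2 = S * T x^2 := by rw [mul_pow, haS]
  have hr4 : (a * T x)^4 = (S * T x^2)^2 := by rw [← hr2]; ring
  rw [hn, hn4, hφ2, ← Complex.ofReal_pow, ← Complex.ofReal_pow, hr2, hr4, hφe]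
  have hkey : β * (1 + ε^2 * d₁^2) = 2 * ε * S * (1 - T x^2) * B x := by
    rw [hβ]; linear_combination (ε * S * (1 - T x^2) * B x) * hc2
  have hkey' := congrArg (fun t : ℝ => (t : ℂ)) hkey
  simp only [hB] at hkey'
  push_cast at hkey' ⊢
  linear_combination (-(1/2) * Complex.I * (a * T x) * Θ x) * hkey' -
    (1/2 * ε * d₁ * β * (a * T x) * Θ x) * Complex.I_sq

lemma e0_val (d₁ d₃ d₄ : ℝ) {τ : ℝ} (hτ : τ ∈ Set.Icc (0:ℝ) 1) :
    cext (eF d₁ d₃ d₄ (0, 1, 0)) τ = 2 * ((d₁ + d₃ + d₄) / 3 + d₄ * τ / 5) := by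
  rw [cext_of_mem _ hτ, eF, K1, avg_apply]
  have : ∀ w ∈ Set.uIcc (0:ℝ) 1, w^2 * cext (hF d₁ d₃ d₄ (0, 1, 0)) (τ * w^2) =
      (2 * (d₁ + d₃ + d₄)) * w^2 + (2 * d₄ * τ) * w^4 := by
    intro w hw
    rw [Set.uIcc_of_le zero_le_one] at hw
    have hm : τ * w^2 ∈ Set.Icc (0:ℝ) 1 :=
      ⟨mul_nonneg hτ.1 (sq_nonneg _), mul_le_one₀ hτ.2 (sq_nonneg _) (pow_le_one₀ hw.1 hw.2)⟩
    rw [cext_of_mem _ hm]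
    simp [hF, cF, BF, idC]
    ring
  rw [intervalIntegral.integral_congr this, intervalIntegral.integral_add,
    intervalIntegral.integral_const_mul, intervalIntegral.integral_const_mul]
  · simp
    ring
  · apply Continuous.intervalIntegrable; fun_prop
  · apply Continuous.intervalIntegrable; fun_prop

lemma data_exists (d₁ d₃ d₄ : ℝ) : ∃ U : ℝ → CI × ℝ, ∃ K > (0:ℝ), ∃ μ₀ > (0:ℝ),
    Tendsto (fun μ => (U μ).2) (nhds 0) (nhds 0) ∧
    Tendsto (fun μ => ev1 (eF d₁ d₃ d₄ (μ, U μ))) (nhds 0) (nhds (2/3 * (d₁ + d₃ + (8/5) * d₄))) ∧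
    ∀ μ, 0 < μ → μ < μ₀ → FF d₁ d₃ d₄ (μ, U μ) = 0 ∧ ‖(U μ).1 - 1‖ ≤ K * μ ∧ |(U μ).2| ≤ K * μ ∧
      ‖eF d₁ d₃ d₄ (μ, U μ) - eF d₁ d₃ d₄ (0, 1, 0)‖ ≤ K * μ := by
  obtain ⟨U, hU0, hUd, hUF⟩ := implicit_exists d₁ d₃ d₄
  have hed : DifferentiableAt ℝ (fun μ => eF d₁ d₃ d₄ (μ, U μ)) 0 := by
    have h1 : DifferentiableAt ℝ (eF d₁ d₃ d₄) ((0:ℝ), U 0) :=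
      (eF_contDiffAt d₁ d₃ d₄ (U 0)).differentiableAt one_ne_zero
    exact DifferentiableAt.comp (g := eF d₁ d₃ d₄) (f := fun μ => (μ, U μ)) (0:ℝ) h1
      (differentiableAt_id.prodMk hUd)
  obtain ⟨K1, hK1, hb1⟩ := (hUd.isBigO_sub).exists_pos
  obtain ⟨K2, hK2, hb2⟩ := (hed.isBigO_sub).exists_pos
  have hb1' := hb1.bound
  have hb2' := hb2.bound
  obtain ⟨μ₀, hμ₀, hall⟩ := Metric.eventually_nhds_iff.1 (hUF.and (hb1'.and hb2'))
  refine ⟨U, K1 + K2, by positivity, μ₀, hμ₀, ?_, ?_, ?_⟩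
  · have := (continuous_snd.continuousAt (x := U 0)).tendsto.comp hUd.continuousAt.tendsto
    rwa [hU0] at this
  · have := (ev1.continuous.continuousAt (x := eF d₁ d₃ d₄ (0, U 0))).tendsto.comp
      hed.continuousAt.tendsto
    have hv : ev1 (eF d₁ d₃ d₄ (0, U 0)) = 2/3 * (d₁ + d₃ + (8/5) * d₄) := by
      have h1 : (1:ℝ) ∈ Set.Icc (0:ℝ) 1 := by simp
      have h2 := e0_val d₁ d₃ d₄ h1
      rw [cext_of_mem _ h1] at h2
      rw [hU0]
      refine Eq.trans ?_ (h2.trans (by ring))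
      rfl
    rwa [hv] at this
  · intro μ hμ hμ'
    obtain ⟨h1, h2, h3⟩ := hall (y := μ) (by rw [Real.dist_eq, sub_zero, abs_of_pos hμ]; exact hμ')
    rw [sub_zero, Real.norm_of_nonneg hμ.le] at h2 h3
    rw [hU0] at h2 h3
    have e1 : K1 * μ ≤ (K1 + K2) * μ := by nlinarith
    have e2 : K2 * μ ≤ (K1 + K2) * μ := by nlinarith
    refine ⟨h1, ?_, ?_, h3.trans e2⟩
    · exact (norm_fst_le (U μ - (1, 0))).trans (h2.trans e1)
    · have := (norm_snd_le (U μ - (1, 0))).trans (h2.trans e1)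
      simpa using this


set_option maxHeartbeats 1000000 in
/-- Persistence of the dark soliton as a regular perturbation (σ = 0 case). -/
theorem dark_soliton_persistence (d₁ d₃ d₄ : ℝ)
    (hΓ : d₁ + d₃ + 2*d₄ ≠ 0) (hb : d₁ + d₃ + (8/5)*d₄ ≠ 0) :
    ∃ ε₀ > (0:ℝ), ∃ C > (0:ℝ), ∃ σstar : ℝ → ℝ,
      Tendsto σstar (nhdsWithin 0 (Set.Ioi 0))
        (nhds (-(2/9) * (d₁ + d₃ + (8/5)*d₄)^2 * (d₁ + d₃ + 2*d₄))) ∧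
      ∀ ε ∈ Set.Ioo (0:ℝ) ε₀, ∀ d₂ : ℝ, d₂ = -d₃ - d₄ - ε^2 * σstar ε →
        ∃ r ψ : ℝ → ℝ,
          steadyODE d₁ d₂ d₃ d₄ ε (polarSol r ψ) ∧
          (∀ x : ℝ, |r x - Real.tanh x| ≤ C * ε^2) ∧
          (∀ x : ℝ, |ψ x - ε * psiEps d₁ d₃ d₄ x| ≤ C * ε^3) := by
  obtain ⟨U, K, hK, μ₀, hμ₀, hlim1, hlim2, hdata⟩ := data_exists d₁ d₃ d₄
  set Γ := d₁ + d₃ + 2*d₄ with hΓd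
  set M := 2 * (|d₁ + d₃ + d₄| + |d₄|) with hM
  have hM0 : 0 ≤ M := by positivity
  have hsq : Tendsto (fun ε : ℝ => ε^2) (nhdsWithin 0 (Set.Ioi 0)) (nhds 0) := by
    have : Tendsto (fun ε : ℝ => ε^2) (nhds 0) (nhds (0^2)) := (continuous_pow 2).tendsto 0
    rw [zero_pow two_ne_zero] at this
    exact this.mono_left nhdsWithin_le_nhds
  refine ⟨min 1 (min μ₀ (1 / (16 * K))), by positivity, (5 + 5 * M) * K, by positivity,
    fun ε => (-Γ * (U (ε^2)).2 + d₄ * (U (ε^2)).2^2) / ε^2, ?_, ?_⟩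
  · have l1 := hlim1.comp hsq
    have l2 := hlim2.comp hsq
    have l3 : Tendsto (fun ε : ℝ => (-Γ + d₄ * (U (ε^2)).2) * (1 - (U (ε^2)).2) *
        (ev1 (eF d₁ d₃ d₄ (ε^2, U (ε^2))))^2 / 2) (nhdsWithin 0 (Set.Ioi 0))
        (nhds ((-Γ + d₄ * 0) * (1 - 0) * (2/3 * (d₁ + d₃ + (8/5) * d₄))^2 / 2)) :=
      (((tendsto_const_nhds.add (l1.const_mul d₄)).mul (tendsto_const_nhds.sub l1)).mul
        (l2.pow 2)).div_const 2
    have e : (-Γ + d₄ * 0) * (1 - 0) * (2/3 * (d₁ + d₃ + (8/5) * d₄))^2 / 2 =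
        -(2/9) * (d₁ + d₃ + (8/5)*d₄)^2 * Γ := by ring
    rw [e] at l3
    refine l3.congr' ?_
    filter_upwards [hsq.eventually (gt_mem_nhds hμ₀), self_mem_nhdsWithin] with ε h1 h2
    have hε : (0:ℝ) < ε := h2
    obtain ⟨hF, -⟩ := hdata (ε^2) (by positivity) h1
    have hF2 : (U (ε^2)).2 - ε^2 * (1 - (U (ε^2)).2) * (ev1 (eF d₁ d₃ d₄ (ε^2, U (ε^2))))^2 / 2 = 0 :=
      congrArg Prod.snd hF
    rw [eq_div_iff (by positivity)]
    linear_combination (-(-Γ + d₄ * (U (ε^2)).2)) * hF2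
  · intro ε hε d₂ hd₂
    obtain ⟨hε0, hε1⟩ := hε
    rw [lt_min_iff, lt_min_iff] at hε1
    obtain ⟨hε1, hε2, hε3⟩ := hε1
    have hle : ε^2 < ε := by nlinarith
    obtain ⟨hF, hz1, hδ1, he1⟩ := hdata (ε^2) (by positivity) (hle.trans hε2)
    set k := K * ε^2 with hk
    have hk0 : 0 < k := by positivity
    have hk1 : k ≤ 1/16 := by
      rw [lt_div_iff₀ (by positivity)] at hε3
      nlinarith
    set z := (U (ε^2)).1 with hz
    set δ := (U (ε^2)).2 with hδ
    have hF' : FF d₁ d₃ d₄ (ε^2, z, δ) = 0 := hF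
    have he1' : ‖eF d₁ d₃ d₄ (ε^2, z, δ) - eF d₁ d₃ d₄ (0, 1, 0)‖ ≤ k := he1
    have hδ2 := abs_le.1 hδ1
    have hδlt : δ < 1 := by linarith [hδ2.2]
    have hzc : ∀ τ, |cext z τ - 1| ≤ k := fun τ => by
      have := (cext_abs_le (z - 1) τ).trans hz1
      simpa [cext] using this
    have hzpos : ∀ τ, 0 < cext z τ := fun τ => by linarith [(abs_le.1 (hzc τ)).1]
    set a := √(1 - δ) with ha
    have hapos : 0 < a := Real.sqrt_pos.2 (by linarith)
    have haS : a^2 = 1 - δ := Real.sq_sqrt (by linarith)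
    have ha1 : |a - 1| ≤ k := by
      rw [abs_le]; constructor
      · nlinarith [hδ2.1, hδ2.2]
      · nlinarith [hδ2.1, hδ2.2]
    have ha2 := abs_le.1 ha1
    have htanh : Continuous Real.tanh :=
      continuous_iff_continuousAt.2 fun y => (tanh_deriv y).continuousAt
    have hzcont := cext_cont z
    obtain ⟨Y, hY, hYt⟩ := Y_exists (fun t => cext z (Real.tanh t^2) / a) (by fun_prop)
      (κ := 4 * k) (by positivity) (by linarith) (fun t => by
        have h1 := abs_le.1 (hzc (Real.tanh t^2))
        have : cext z (Real.tanh t^2) / a - 1 = (cext z (Real.tanh t^2) - a) / a := by field_simp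
        rw [this, abs_div, abs_of_pos hapos, div_le_iff₀ hapos, abs_le]
        constructor <;> nlinarith)
    set T : ℝ → ℝ := fun x => Real.tanh (Y x) with hT
    have hT1 : ∀ x, T x^2 < 1 := fun x => Real.tanh_sq_lt_one _
    have hTd : ∀ x, HasDerivAt T (a * (1 - T x^2) / cext z (T x^2)) x := fun x => by
      refine ((tanh_deriv (Y x)).comp x (hY x)).congr_deriv ?_
      rw [inv_div, hT]; ring
    have hode := ode_main d₁ d₃ d₄ ε δ z hF' hδlt hzpos T hTd hT1
    have hd₂' : d₂ = d₁ - (d₁ + d₃) * (1 - δ) - d₄ * (1 - δ)^2 := by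
      rw [hd₂, mul_div_cancel₀ _ (by positivity)]; ring
    rw [hd₂']
    have hTabs : ∀ x, |T x| ≤ 1 := fun x => (Real.abs_tanh_lt_one _).le
    refine ⟨_, _, hode, fun x => ?_, fun x => ?_⟩
    · have e : a * T x - Real.tanh x = (a - 1) * T x + (T x - Real.tanh x) := by ring
      have h1 : |(a - 1) * T x| ≤ k * 1 := by
        rw [abs_mul]; exact mul_le_mul ha1 (hTabs x) (abs_nonneg _) hk0.le
      calc |a * T x - Real.tanh x| ≤ |(a - 1) * T x| + |T x - Real.tanh x| := by
            rw [e]; exact abs_add_le _ _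
        _ ≤ k * 1 + 4 * k := add_le_add h1 (hYt x)
        _ ≤ (5 + 5 * M) * K * ε^2 := by
          have e2 : (5 + 5 * M) * K * ε^2 = (5 + 5 * M) * k := by rw [hk]; ring
          rw [e2]; nlinarith [mul_nonneg hM0 hk0.le]
    · set t := Real.tanh x with ht
      have htabs : |t| ≤ 1 := (Real.abs_tanh_lt_one _).le
      set E := cext (eF d₁ d₃ d₄ (ε^2, z, δ)) (T x^2) with hE
      set A := d₁ + d₃ + d₄ with hA
      have hmem : T x^2 ∈ Set.Icc (0:ℝ) 1 := ⟨sq_nonneg _, (hT1 x).le⟩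
      have hEE : |E - 2 * (A / 3 + d₄ * T x^2 / 5)| ≤ k := by
        rw [← e0_val d₁ d₃ d₄ hmem]
        exact (cext_abs_le (eF d₁ d₃ d₄ (ε^2, z, δ) - eF d₁ d₃ d₄ (0, 1, 0)) (T x^2)).trans he1'
      have hE0 : ∀ y, |y| ≤ 3 → |2 * (A / 3 + d₄ * y / 5)| ≤ M := fun y hy => by
        rw [abs_mul, abs_two, hM]
        have h1 : |A / 3 + d₄ * y / 5| ≤ |A| / 3 + |d₄| * |y| / 5 := by
          refine (abs_add_le _ _).trans (le_of_eq ?_)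
          rw [abs_div, abs_div, abs_mul]
          norm_num
        have h2 : |d₄| * |y| ≤ |d₄| * 3 := mul_le_mul_of_nonneg_left hy (abs_nonneg _)
        have := abs_nonneg A
        have := abs_nonneg d₄
        linarith
      have e : ε * (a * T x) * E - ε * psiEps d₁ d₃ d₄ x =
          ε * (a * (T x * (E - 2 * (A / 3 + d₄ * T x^2 / 5)))
            + ((a - 1) * T x) * (2 * (A / 3 + d₄ * T x^2 / 5))
            + (T x - t) * (2 * (A / 3 + d₄ * (T x^2 + T x * t + t^2) / 5))) := by
        rw [psiEps, ← ht, ← hA]; ring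
      have b1 : |a * (T x * (E - 2 * (A / 3 + d₄ * T x^2 / 5)))| ≤ 2 * (1 * k) := by
        rw [abs_mul, abs_mul, abs_of_pos hapos]
        refine mul_le_mul (by linarith) ?_ (by positivity) (by norm_num)
        exact mul_le_mul (hTabs x) hEE (abs_nonneg _) zero_le_one
      have b2 : |((a - 1) * T x) * (2 * (A / 3 + d₄ * T x^2 / 5))| ≤ k * 1 * M := by
        rw [abs_mul, abs_mul]
        refine mul_le_mul ?_ (hE0 _ ?_) (abs_nonneg _) (by positivity)
        · exact mul_le_mul ha1 (hTabs x) (abs_nonneg _) hk0.le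
        · rw [abs_of_nonneg hmem.1]; linarith [hmem.2]
      have b3 : |(T x - t) * (2 * (A / 3 + d₄ * (T x^2 + T x * t + t^2) / 5))| ≤ 4 * k * M := by
        rw [abs_mul]
        refine mul_le_mul (hYt x) (hE0 _ ?_) (abs_nonneg _) (by positivity)
        have h1 := hmem.2
        have h2 : t^2 ≤ 1 := (Real.tanh_sq_lt_one x).le
        have h3 := sq_nonneg (T x - t)
        have h4 := sq_nonneg (T x + t)
        have h5 := sq_nonneg (T x)
        have h6 := sq_nonneg t
        clear_value T t
        rw [abs_le]; constructor <;> linarith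
      change |ε * (a * T x) * E - ε * psiEps d₁ d₃ d₄ x| ≤ _
      rw [e, abs_mul, abs_of_pos hε0]
      have b4 := (abs_add_le _ _).trans (add_le_add ((abs_add_le _ _).trans (add_le_add b1 b2)) b3)
      calc _ ≤ ε * (2 * (1 * k) + k * 1 * M + 4 * k * M) := mul_le_mul_of_nonneg_left b4 hε0.le
        _ ≤ ε * ((5 + 5 * M) * k) := mul_le_mul_of_nonneg_left (by linarith [hk0]) hε0.le
        _ = (5 + 5 * M) * K * ε^3 := by rw [hk]; ring
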